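/- Let n ≥ 1, 1 ≤ k ≤ n, m ≥ 1 be integers and let G = G(n,k,m) be the bipartite graph with vertex parts N = [n] and M = {S ⊆ [n] : |S| = k} × [m], where u ∈ N is joined to (S,v) ∈ M iff u ∈ S. Then every nonempty subgraph H of G satisfies e(H)/v(H) < k; i.e., m(G) < k. -/

import Mathlib

/-- The bipartite graph `G(n,k,m)` with parts `[n]` and `binom([n],k) × [m]`, where
`u ∈ [n]` is joined to `(S,v)` iff `u ∈ S`. -/
def gadgetGraph (n k m : ℕ) :
    SimpleGraph (Fin n ⊕ ({S : Finset (Fin n) // S.card = k} × Fin m)) :=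
  SimpleGraph.fromRel (fun x y =>
    ∃ (u : Fin n) (p : {S : Finset (Fin n) // S.card = k} × Fin m),
      x = Sum.inl u ∧ y = Sum.inr p ∧ u ∈ p.1.val)

/-- every nonempty subgraph `H` of `G(n,k,m)` satisfies `e(H)/v(H) < k`,
i.e. `m(G(n,k,m)) < k`. -/
theorem stmt3 (n k m : ℕ) (hn : 1 ≤ n) (hk : 1 ≤ k) (hkn : k ≤ n) (hm : 1 ≤ m) :
    ∀ H : (gadgetGraph n k m).Subgraph, H.verts.Nonempty →
      (H.edgeSet.ncard : ℚ) / (H.verts.ncard : ℚ) < (k : ℚ) := by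
  classical
  intro H hH
  let B : Finset ({S : Finset (Fin n) // S.card = k} × Fin m) :=
    Finset.univ.filter (fun p => Sum.inr p ∈ H.verts)
  have key : ∀ e ∈ H.edgeSet, ∃ u p, e = s(Sum.inl u, Sum.inr p) ∧ u ∈ p.1.val ∧
      Sum.inl u ∈ H.verts ∧ Sum.inr p ∈ H.verts := by
    intro e
    induction e using Sym2.ind with
    | _ x y =>
      intro he
      rw [SimpleGraph.Subgraph.mem_edgeSet] at he
      have ha := H.adj_sub he
      have h1 := H.edge_vert he
      have h2 := H.edge_vert he.symm
      unfold gadgetGraph at ha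
      rw [SimpleGraph.fromRel_adj] at ha
      obtain ⟨-, ⟨u, p, rfl, rfl, hu⟩ | ⟨u, p, rfl, rfl, hu⟩⟩ := ha
      · exact ⟨u, p, rfl, hu, h1, h2⟩
      · exact ⟨u, p, Sym2.eq_swap, hu, h2, h1⟩
  have hvpos : 0 < H.verts.ncard := (Set.ncard_pos (Set.toFinite _)).2 hH
  rw [div_lt_iff₀ (by exact_mod_cast hvpos)]
  suffices h : H.edgeSet.ncard < k * H.verts.ncard by exact_mod_cast h
  by_cases hex : ∃ u, Sum.inl u ∈ H.verts
  · obtain ⟨u, hu⟩ := hex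
    have hE : H.edgeSet.ncard ≤ B.card * k := by
      let T : Finset (Sym2 (Fin n ⊕ ({S : Finset (Fin n) // S.card = k} × Fin m))) :=
        B.biUnion (fun p => p.1.val.image (fun u => s(Sum.inl u, Sum.inr p)))
      have hsub : H.edgeSet ⊆ (T : Set _) := by
        intro e he
        obtain ⟨u, p, rfl, hu, h1, h2⟩ := key e he
        rw [Finset.mem_coe, Finset.mem_biUnion]
        exact ⟨p, Finset.mem_filter.2 ⟨Finset.mem_univ _, h2⟩, Finset.mem_image.2 ⟨u, hu, rfl⟩⟩
      have := Set.ncard_le_ncard hsub (Finset.finite_toSet T)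
      rw [Set.ncard_coe_finset] at this
      refine this.trans (Finset.card_biUnion_le_card_mul _ _ _ ?_)
      intro p _
      exact Finset.card_image_le.trans p.1.2.le
    have hV : B.card + 1 ≤ H.verts.ncard := by
      let W : Finset (Fin n ⊕ ({S : Finset (Fin n) // S.card = k} × Fin m)) :=
        insert (Sum.inl u) (B.image Sum.inr)
      have hW : W.card = B.card + 1 := by
        rw [Finset.card_insert_of_notMem (by simp),
          Finset.card_image_of_injective _ Sum.inr_injective]
      have hsub : (W : Set _) ⊆ H.verts := by
        intro x hx
        rcases Finset.mem_insert.1 (Finset.mem_coe.1 hx) with rfl | hx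
        · exact hu
        · obtain ⟨p, hp, rfl⟩ := Finset.mem_image.1 hx
          exact (Finset.mem_filter.1 hp).2
      have := Set.ncard_le_ncard hsub (Set.toFinite _)
      rwa [Set.ncard_coe_finset, hW] at this
    nlinarith
  · have : H.edgeSet = ∅ := by
      rw [Set.eq_empty_iff_forall_notMem]
      intro e he
      obtain ⟨u, p, -, -, h1, -⟩ := key e he
      exact hex ⟨u, h1⟩
    rw [this, Set.ncard_empty]
    exact Nat.mul_pos hk hvpos
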